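/- arXiv:1407.0970 — 2 statements merged into one kernel-verified Lean document; each statement's English description precedes it below -/
import Mathlib

section
/- Let α be a type and let S and S' be finite sets of pairs over α. If S.card ≤ S'.card and 9 < S.card, then the following are equivalent: (1) every pair in S intersects every pair in S'; (2) there exists an element a : α such that a belongs to every pair in S and a belongs to every pair in S'. -/
/-- A pair that intersects at least three pairs, all containing `p`, contains `p` itself. -/
theorem mem_of_intersects_star {α : Type*} {T : Finset (Multiset α)} {s : Multiset α} {p : α}
    (hT : ∀ t ∈ T, Multiset.card t = 2) (hp : ∀ t ∈ T, p ∈ t) (hcard : 2 < T.card)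
    (hs : Multiset.card s = 2) (h : ∀ t ∈ T, ∃ z, z ∈ s ∧ z ∈ t) : p ∈ s := by
  classical
  by_contra hps
  have hsub : T ⊆ s.toFinset.image (fun x => ({p, x} : Multiset α)) := by
    intro t ht
    obtain ⟨z, hzs, hzt⟩ := h t ht
    obtain ⟨u, rfl⟩ := Multiset.exists_cons_of_mem (hp t ht)
    have hu : Multiset.card u = 1 := by simpa using hT _ ht
    obtain ⟨x, rfl⟩ := Multiset.card_eq_one.mp hu
    have hzp : z ≠ p := fun e => hps (e ▸ hzs)
    have hzx : z = x := by simpa [hzp] using hzt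
    subst hzx
    exact Finset.mem_image.mpr ⟨z, Multiset.mem_toFinset.mpr hzs, rfl⟩
  have h₁ := (Finset.card_le_card hsub).trans Finset.card_image_le
  have h₂ := Multiset.toFinset_card_le s
  omega

/-- A *pair* over `α` is a multiset over `α` of cardinality 2. Given two finite
families `S` and `S'` of pairs with `S.card ≤ S'.card` and `9 < S.card`,
every pair in `S` intersects every pair in `S'` iff there is a single element
belonging to every pair in `S` and every pair in `S'`. -/
theorem stmt_0 {α : Type*} (S S' : Finset (Multiset α))
    (hS : ∀ s ∈ S, Multiset.card s = 2)
    (hS' : ∀ s ∈ S', Multiset.card s = 2)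
    (hle : S.card ≤ S'.card) (hbig : 9 < S.card) :
    (∀ s ∈ S, ∀ s' ∈ S', ∃ z, z ∈ s ∧ z ∈ s') ↔
      ∃ a : α, (∀ s ∈ S, a ∈ s) ∧ (∀ s' ∈ S', a ∈ s') := by
  classical
  constructor
  · intro h
    obtain ⟨s₀, hs₀⟩ : S.Nonempty := Finset.card_pos.mp (by omega)
    obtain ⟨p, q, rfl⟩ := Multiset.card_eq_two.mp (hS s₀ hs₀)
    have hcover : S' ⊆ S'.filter (fun t => p ∈ t) ∪ S'.filter (fun t => q ∈ t) := by
      intro t ht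
      obtain ⟨z, hz, hzt⟩ := h _ hs₀ t ht
      have hz' : z = p ∨ z = q := by simpa using hz
      rcases hz' with rfl | rfl <;> simp [ht, hzt]
    have hcard := (Finset.card_le_card hcover).trans (Finset.card_union_le _ _)
    obtain ⟨a, ha⟩ : ∃ a, 2 < (S'.filter (fun t => a ∈ t)).card := by
      by_contra! hsmall
      have h₁ := hsmall p
      have h₂ := hsmall q
      omega
    have haS : ∀ s ∈ S, a ∈ s := fun s hs =>
      mem_of_intersects_star (fun t ht => hS' t (Finset.mem_filter.mp ht).1)
        (fun t ht => (Finset.mem_filter.mp ht).2) ha (hS s hs)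
        (fun t ht => h s hs t (Finset.mem_filter.mp ht).1)
    exact ⟨a, haS, fun s' hs' =>
      mem_of_intersects_star hS haS (by omega) (hS' s' hs')
        (fun t ht => (h t ht s' hs').imp fun _ hz => hz.symm)⟩
  · rintro ⟨a, ha, ha'⟩ s hs s' hs'
    exact ⟨a, ha s hs, ha' s' hs'⟩
end

section
/- Let α be a type and let S be a set of pairs over α in which at least 4 distinct elements of α occur (i.e. the set {x : α | ∃ s ∈ S, x ∈ s} has at least 4 elements). Then at least one of the following holds: (i) there exist pairwise distinct a, b, c, d with {a,b} ∈ S, {a,c} ∈ S, and {a,d} ∈ S; (ii) there exist pairwise distinct a, b, c, d with {a,b} ∈ S and {c,d} ∈ S; (iii) there exist pairwise distinct a, b, c with {a,a} ∈ S and {b,c} ∈ S; (iv) there exist distinct a, b with {a,a} ∈ S and {b,b} ∈ S. -/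
/-- A symmetric relation, loops allowed, in which at least four elements are related to something
contains a three-edge star, two disjoint edges, a loop disjoint from an edge, or two loops. -/
theorem exists_star_or_disjoint_edges {α : Type*} {r : α → α → Prop} (symm : ∀ a b, r a b → r b a)
    (h : 4 ≤ {x | ∃ y, r x y}.encard) :
    (∃ a b c d : α, a ≠ b ∧ a ≠ c ∧ a ≠ d ∧ b ≠ c ∧ b ≠ d ∧ c ≠ d ∧ r a b ∧ r a c ∧ r a d) ∨
    (∃ a b c d : α, a ≠ b ∧ a ≠ c ∧ a ≠ d ∧ b ≠ c ∧ b ≠ d ∧ c ≠ d ∧ r a b ∧ r c d) ∨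
    (∃ a b c : α, a ≠ b ∧ a ≠ c ∧ b ≠ c ∧ r a a ∧ r b c) ∨
    (∃ a b : α, a ≠ b ∧ r a a ∧ r b b) := by
  obtain ⟨T, hT, hT4⟩ := Set.exists_subset_encard_eq h
  obtain ⟨p, x, y, z, hpx, hpy, hpz, hxy, hxz, hyz, rfl⟩ := Set.encard_eq_four.1 hT4
  obtain ⟨p', hp⟩ := hT (show p ∈ _ by simp)
  obtain ⟨x', hx⟩ := hT (show x ∈ _ by simp)
  obtain ⟨y', hy⟩ := hT (show y ∈ _ by simp)
  obtain ⟨z', hz⟩ := hT (show z ∈ _ by simp)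
  by_contra! hn
  obtain ⟨star, disj, loop, loops⟩ := hn
  have key : ∀ u u', r u u' → u ≠ p → u ≠ p' → r p u ∨ r p' u := by
    intro u u' hu hup hup'
    by_cases huu : u = u'
    · subst huu
      by_cases hpp : p = p'
      · subst hpp
        exact absurd hp (loops u p hup hu)
      · exact absurd hp (loop u p p' hup hup' hpp hu)
    by_cases hpu : u' = p
    · exact .inl (hpu ▸ symm _ _ hu)
    by_cases hpu' : u' = p'
    · exact .inr (hpu' ▸ symm _ _ hu)
    by_cases hpp : p = p'
    · subst hpp
      exact absurd hu (loop p u u' hup.symm (Ne.symm hpu) huu hp)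
    · exact absurd hp (disj u u' p p' huu hup hup' hpu hpu' hpp hu)
  by_cases hpp : p = p'
  · subst hpp
    exact star p x y z hpx hpy hpz hxy hxz hyz (or_self_iff.1 (key x x' hx hpx.symm hpx.symm))
      (or_self_iff.1 (key y y' hy hpy.symm hpy.symm))
      (or_self_iff.1 (key z z' hz hpz.symm hpz.symm))
  have two : ∀ u u' v v', r u u' → r v v' → u ≠ v → p ≠ u → p ≠ v → u ≠ p' → v ≠ p' → False := by
    intro u u' v v' hu hv huv hpu hpv hup hvp
    rcases key u u' hu hpu.symm hup with h₁ | h₁ <;> rcases key v v' hv hpv.symm hvp with h₂ | h₂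
    · exact star p p' u v hpp hpu hpv hup.symm hvp.symm huv hp h₁ h₂
    · exact disj p u p' v hpu hpp hpv hup huv hvp.symm h₁ h₂
    · exact disj p v p' u hpv hpp hpu hvp huv.symm hup.symm h₂ h₁
    · exact star p' p u v (Ne.symm hpp) hup.symm hvp.symm hpu hpv huv (symm _ _ hp) h₁ h₂
  by_cases hxp : x = p'
  · exact two y y' z z' hy hz hyz hpy hpz (hxp ▸ hxy.symm) (hxp ▸ hxz.symm)
  by_cases hyp : y = p'
  · exact two x x' z z' hx hz hxz hpx hpz hxp (hyp ▸ hyz.symm)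
  exact two x x' y y' hx hy hxy hpx hpy hxp hyp

/-- A *pair* over `α` is a multiset over `α` of cardinality 2. If at least 4
distinct elements of `α` occur among the members of a set `S` of pairs, then
one of the four listed configurations occurs in `S`. -/
theorem stmt_2 {α : Type*} (S : Set (Multiset α))
    (hS : ∀ s ∈ S, Multiset.card s = 2)
    (h4 : 4 ≤ {x : α | ∃ s ∈ S, x ∈ s}.encard) :
    (∃ a b c d : α, a ≠ b ∧ a ≠ c ∧ a ≠ d ∧ b ≠ c ∧ b ≠ d ∧ c ≠ d ∧
      ({a, b} : Multiset α) ∈ S ∧ ({a, c} : Multiset α) ∈ S ∧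
      ({a, d} : Multiset α) ∈ S) ∨
    (∃ a b c d : α, a ≠ b ∧ a ≠ c ∧ a ≠ d ∧ b ≠ c ∧ b ≠ d ∧ c ≠ d ∧
      ({a, b} : Multiset α) ∈ S ∧ ({c, d} : Multiset α) ∈ S) ∨
    (∃ a b c : α, a ≠ b ∧ a ≠ c ∧ b ≠ c ∧
      ({a, a} : Multiset α) ∈ S ∧ ({b, c} : Multiset α) ∈ S) ∨
    (∃ a b : α, a ≠ b ∧
      ({a, a} : Multiset α) ∈ S ∧ ({b, b} : Multiset α) ∈ S) := by
  have pair : ∀ x, (∃ s ∈ S, x ∈ s) → ∃ y, ({x, y} : Multiset α) ∈ S := by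
    rintro x ⟨s, hs, hxs⟩
    obtain ⟨t, rfl⟩ := Multiset.exists_cons_of_mem hxs
    obtain ⟨y, rfl⟩ := Multiset.card_eq_one.1 (by simpa using hS _ hs)
    exact ⟨y, hs⟩
  exact exists_star_or_disjoint_edges (r := fun a b => ({a, b} : Multiset α) ∈ S)
    (fun a b hab => Multiset.pair_comm a b ▸ hab) (h4.trans (Set.encard_le_encard pair))
end
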